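/- Let k ≥ 6 and let b1,…,b8 be functions in the Bell space W_k(T) satisfying the dual-basis conditions: every Bell degree-of-freedom functional (for this k) vanishes on each b_i, except that b1(1/(k−2),0)=1, b2(2/(k−2),0)=1, ∂_y b3(1/(k−3),0)=1, ∂_y b4(2/(k−3),0)=1, b5(1,0)=1, ∂_x b6(1,0)=1, ∂_y b7(1,0)=1, ∂_{xy} b8(1,0)=1, each b_i taking value 1 only at its own designated functional and 0 at all other Bell functionals. Then P_k ∩ span{b1,…,b8} = {0}, i.e. if p + c1·b1 + … + c8·b8 = 0 with p ∈ P_k and real c_i, then p = 0 and all c_i = 0; consequently the space V_k(T) = P_k + span{b1,…,b8} has dimension (k+1)(k+2)/2 + 8. -/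

import Mathlib

open MvPolynomial

noncomputable section

/-- A bivariate real polynomial; variable `0` is `x`, variable `1` is `y`. -/
abbrev Poly2 : Type := MvPolynomial (Fin 2) ℝ

/-- Evaluation of a bivariate polynomial at the point `(a, b)`. -/
def ev (p : Poly2) (a b : ℝ) : ℝ := MvPolynomial.eval ![a, b] p

/-- The partial derivative `∂ₓ`. -/
def dX (p : Poly2) : Poly2 := MvPolynomial.pderiv 0 p

/-- The partial derivative `∂_y`. -/
def dY (p : Poly2) : Poly2 := MvPolynomial.pderiv 1 p

/-- Restriction of `p` to the vertical line `x = c`, as a univariate polynomial in `y`. -/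
def lineX (c : ℝ) (p : Poly2) : Polynomial ℝ :=
  MvPolynomial.aeval (fun i : Fin 2 => if i = 0 then Polynomial.C c else Polynomial.X) p

/-- Restriction of `p` to the horizontal line `y = c`, as a univariate polynomial in `x`. -/
def lineY (c : ℝ) (p : Poly2) : Polynomial ℝ :=
  MvPolynomial.aeval (fun i : Fin 2 => if i = 0 then Polynomial.X else Polynomial.C c) p

/-- The Bell space `W_k(T)` on the unit square: `v ∈ Q_k` such that on each edge the
normal derivative has degree at most `k - 1` in the edge variable. -/
def BellSpace (k : ℕ) (v : Poly2) : Prop :=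
  v.degreeOf 0 ≤ k ∧ v.degreeOf 1 ≤ k ∧
  (lineX 0 (dX v)).natDegree ≤ k - 1 ∧ (lineX 1 (dX v)).natDegree ≤ k - 1 ∧
  (lineY 0 (dY v)).natDegree ≤ k - 1 ∧ (lineY 1 (dY v)).natDegree ≤ k - 1

/-- The set of Bell degree-of-freedom functionals on the unit square, for degree `k`. -/
def BellDofs (k : ℕ) : Set (Poly2 → ℝ) :=
  { F | (∃ i j : ℕ, i ≤ k - 2 ∧ j ≤ k - 2 ∧
          F = fun v => ev v ((i : ℝ) / ((k : ℝ) - 2)) ((j : ℝ) / ((k : ℝ) - 2))) ∨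
        (∃ i j : ℕ, i ≤ 1 ∧ j ≤ k - 3 ∧
          F = fun v => ev (dX v) (i : ℝ) ((j : ℝ) / ((k : ℝ) - 3))) ∨
        (∃ i j : ℕ, i ≤ k - 3 ∧ j ≤ 1 ∧
          F = fun v => ev (dY v) ((i : ℝ) / ((k : ℝ) - 3)) (j : ℝ)) ∨
        (∃ i j : ℕ, i ≤ 1 ∧ j ≤ 1 ∧
          F = fun v => ev (dX (dY v)) (i : ℝ) (j : ℝ)) }

/-- `b` is the Bell nodal basis function dual to the degree-of-freedom functional `F0`:
`F0 b = 1` and every other Bell degree-of-freedom functional vanishes on `b`. -/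
def IsDualTo (k : ℕ) (F0 : Poly2 → ℝ) (b : Poly2) : Prop :=
  F0 b = 1 ∧ ∀ F ∈ BellDofs k, F ≠ F0 → F b = 0

theorem eval_lineX (c t : ℝ) (p : Poly2) : (lineX c p).eval t = ev p c t := by
  induction p using MvPolynomial.induction_on with
  | C a => simp [lineX, ev]
  | add p q hp hq => simp_all [lineX, ev]
  | mul_X p i hp => fin_cases i <;> simp_all [lineX, ev]

theorem eval_lineY (c t : ℝ) (p : Poly2) : (lineY c p).eval t = ev p t c := by
  induction p using MvPolynomial.induction_on with
  | C a => simp [lineY, ev]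
  | add p q hp hq => simp_all [lineY, ev]
  | mul_X p i hp => fin_cases i <;> simp_all [lineY, ev]

theorem derivative_lineX (c : ℝ) (p : Poly2) :
    (lineX c p).derivative = lineX c (dY p) := by
  induction p using MvPolynomial.induction_on with
  | C a => simp [lineX, dY]
  | add p q hp hq => simp_all [lineX, dY]
  | mul_X p i hp => fin_cases i <;> simp_all [lineX, dY, Derivation.leibniz] <;> ring

theorem derivative_lineY (c : ℝ) (p : Poly2) :
    (lineY c p).derivative = lineY c (dX p) := by
  induction p using MvPolynomial.induction_on with
  | C a => simp [lineY, dX]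
  | add p q hp hq => simp_all [lineY, dX]
  | mul_X p i hp => fin_cases i <;> simp_all [lineY, dX, Derivation.leibniz] <;> ring

theorem natDegree_lineX_le (c : ℝ) {p : Poly2} {n : ℕ} (h : p.totalDegree ≤ n) :
    (lineX c p).natDegree ≤ n := by
  refine (MvPolynomial.aeval_natDegree_le (n := 1) p h _ fun i => ?_).trans (mul_one n).le
  fin_cases i <;> simp

theorem natDegree_lineY_le (c : ℝ) {p : Poly2} {n : ℕ} (h : p.totalDegree ≤ n) :
    (lineY c p).natDegree ≤ n := by
  refine (MvPolynomial.aeval_natDegree_le (n := 1) p h _ fun i => ?_).trans (mul_one n).le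
  fin_cases i <;> simp

theorem totalDegree_pderiv_le_sub_one {σ R : Type*} [CommSemiring R] (i : σ)
    (p : MvPolynomial σ R) : (pderiv i p).totalDegree ≤ p.totalDegree - 1 := by
  refine Finset.sup_le fun m hm => ?_
  rw [mem_support_iff, coeff_pderiv] at hm
  have h := le_totalDegree (mem_support_iff.2 (left_ne_zero_of_mul hm))
  rw [Finsupp.sum_add_index' (fun _ => rfl) (fun _ _ _ => rfl),
    Finsupp.sum_single_index rfl] at h
  omega

theorem dX_dY_comm (p : Poly2) : dY (dX p) = dX (dY p) := by
  ext m
  simp only [dX, dY, coeff_pderiv, add_right_comm m]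
  simp
  ring

theorem X_sub_C_dvd_of_eval_eq_zero {σ R : Type*} [CommRing R] [IsDomain R] [Infinite R]
    (i : σ) (c : R) {p : MvPolynomial σ R} (h : ∀ v : σ → R, v i = c → eval v p = 0) :
    X i - C c ∣ p := by
  classical
  set s : σ → MvPolynomial σ R := Function.update X i (C c) with hs
  have hzero : aeval s p = 0 := by
    refine MvPolynomial.funext fun v => ?_
    rw [map_zero, ← h (Function.update v i c) (by simp), aeval_def, algebraMap_eq,
      ← coe_eval₂Hom, ← RingHom.comp_apply]
    congr 1
    refine ringHom_ext (by simp) fun j => ?_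
    by_cases hj : j = i
    · subst hj; simp [hs]
    · simp [hs, hj]
  have hdvd : ∀ q : MvPolynomial σ R, X i - C c ∣ q - aeval s q := by
    intro q
    induction q using MvPolynomial.induction_on with
    | C a => simp [algebraMap_eq]
    | add p q hp hq => simpa [add_sub_add_comm] using dvd_add hp hq
    | mul_X p j hp =>
      have hX : X i - C c ∣ X j - s j := by
        by_cases hj : j = i
        · subst hj; simp [hs]
        · simp [hs, hj]
      have : p * X j - aeval s (p * X j)
          = (p - aeval s p) * X j + aeval s p * (X j - s j) := by
        simp only [map_mul, aeval_X]; ring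
      rw [this]
      exact dvd_add (hp.mul_right _) (hX.mul_left _)
  have hp := hdvd p
  rwa [hzero, sub_zero] at hp

theorem X_sub_C_sq_dvd {σ R : Type*} [CommRing R] [IsDomain R] [Infinite R]
    (i : σ) (c : R) {p : MvPolynomial σ R} (h : ∀ v : σ → R, v i = c → eval v p = 0)
    (h' : ∀ v : σ → R, v i = c → eval v (pderiv i p) = 0) :
    (X i - C c) ^ 2 ∣ p := by
  obtain ⟨q, rfl⟩ := X_sub_C_dvd_of_eval_eq_zero i c h
  rw [sq]
  refine mul_dvd_mul_left _ (X_sub_C_dvd_of_eval_eq_zero i c fun v hv => ?_)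
  simpa [Derivation.leibniz, hv] using h' v hv

theorem Polynomial.eq_zero_of_natDegree_lt_card_add_two {R : Type*} [CommRing R] [IsDomain R]
    {g : Polynomial R} {S : Finset R} {a b : R} (ha : a ∈ S) (hb : b ∈ S) (hab : a ≠ b)
    (hS : ∀ s ∈ S, g.eval s = 0) (hda : g.derivative.eval a = 0)
    (hdb : g.derivative.eval b = 0) (hdeg : g.natDegree < S.card + 2) : g = 0 := by
  classical
  by_contra hg
  have hle : S.val + {a, b} ≤ g.roots := by
    refine Multiset.le_iff_count.2 fun s => ?_
    rw [Multiset.count_add, Polynomial.count_roots]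
    have hcount : Multiset.count s S.val ≤ 1 := Multiset.nodup_iff_count_le_one.1 S.nodup s
    by_cases hs : s ∈ S
    · have hpos := (Polynomial.rootMultiplicity_pos hg).2 (hS s hs)
      by_cases hsa : s = a
      · subst hsa
        have := (Polynomial.one_lt_rootMultiplicity_iff_isRoot hg).2 ⟨hS s hs, hda⟩
        simp [hab]
        omega
      · by_cases hsb : s = b
        · subst hsb
          have := (Polynomial.one_lt_rootMultiplicity_iff_isRoot hg).2 ⟨hS s hs, hdb⟩
          simp [hsa]
          omega
        · simp [hsa, hsb]
          omega
    · have hsa : s ≠ a := fun h => hs (h ▸ ha)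
      have hsb : s ≠ b := fun h => hs (h ▸ hb)
      simp [hsa, hsb, hs]
  have := (Multiset.card_le_card hle).trans (Polynomial.card_roots' g)
  simp at this
  omega

theorem Polynomial.eq_zero_of_hermite_nodes {m : ℕ} (hm : 0 < m) {g : Polynomial ℝ}
    (hdeg : g.natDegree ≤ m + 2) (h : ∀ j : ℕ, j ≤ m → g.eval ((j : ℝ) / m) = 0)
    (h0 : g.derivative.eval 0 = 0) (h1 : g.derivative.eval 1 = 0) : g = 0 := by
  classical
  have hm' : (m : ℝ) ≠ 0 := by positivity
  have hinj : Function.Injective fun j : ℕ => (j : ℝ) / m := fun i j hij => by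
    simpa [div_left_inj' hm'] using hij
  refine Polynomial.eq_zero_of_natDegree_lt_card_add_two
    (S := (Finset.range (m + 1)).image fun j : ℕ => (j : ℝ) / m) (a := 0) (b := 1)
    (Finset.mem_image.2 ⟨0, by simp⟩) (Finset.mem_image.2 ⟨m, by simp [hm']⟩) zero_ne_one
    ?_ h0 h1 ?_
  · intro s hs
    obtain ⟨j, hj, rfl⟩ := Finset.mem_image.1 hs
    exact h j (by simpa [Nat.lt_succ_iff] using hj)
  · rw [Finset.card_image_of_injective _ hinj, Finset.card_range]
    omega

theorem Polynomial.eq_zero_of_uniform_nodes {m n : ℕ} (hm : 0 < m) {g : Polynomial ℝ}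
    (hdeg : g.natDegree < n)
    (h : ∀ j : ℕ, 1 ≤ j → j ≤ n → g.eval ((j : ℝ) / m) = 0) : g = 0 := by
  have hm' : (m : ℝ) ≠ 0 := by positivity
  refine Polynomial.eq_zero_of_natDegree_lt_card_of_eval_eq_zero g
    (f := fun j : Fin n => ((j + 1 : ℕ) : ℝ) / m) (fun i j hij => ?_)
    (fun j => h _ (by omega) (by omega)) (by simpa using hdeg)
  rw [div_left_inj' hm'] at hij
  exact Fin.ext (by exact_mod_cast (add_left_injective 1 (Nat.cast_injective hij)))

theorem totalDegree_X_sub_C_pos (i : Fin 2) (c : ℝ) :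
    1 ≤ (X i - C c : Poly2).totalDegree := by
  have h := MvPolynomial.aeval_natDegree_le (n := 1) (X i - C c : Poly2) le_rfl
    (fun _ => (Polynomial.X : Polynomial ℝ)) (by simp)
  simpa [← Polynomial.C_eq_algebraMap] using h

theorem totalDegree_X_sub_C_sq_mul (i : Fin 2) (c : ℝ) {q : Poly2} (hq : q ≠ 0) :
    q.totalDegree + 2 ≤ ((X i - C c) ^ 2 * q).totalDegree := by
  have h := totalDegree_X_sub_C_pos i c
  have hne : (X i - C c : Poly2) ≠ 0 := fun h0 => by simp [h0] at h
  rw [totalDegree_mul_of_isDomain (pow_ne_zero 2 hne) hq, sq,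
    totalDegree_mul_of_isDomain hne hne]
  omega

theorem eval_eq_ev (v : Fin 2 → ℝ) (p : Poly2) : eval v p = ev p (v 0) (v 1) := by
  rw [ev]
  congr 2
  ext i
  fin_cases i <;> rfl

theorem eq_zero_of_lineX_eq_zero {m n : ℕ} (hm : 0 < m) {q : Poly2} (hdeg : q.totalDegree < n)
    (h : ∀ j : ℕ, 1 ≤ j → j ≤ n → lineX ((j : ℝ) / m) q = 0) : q = 0 := by
  refine MvPolynomial.funext fun v => ?_
  have hv : lineY (v 1) q = 0 :=
    Polynomial.eq_zero_of_uniform_nodes hm ((natDegree_lineY_le _ le_rfl).trans_lt hdeg)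
      fun j h1 h2 => by rw [eval_lineY, ← eval_lineX, h j h1 h2, Polynomial.eval_zero]
  rw [map_zero, eval_eq_ev, ← eval_lineY, hv, Polynomial.eval_zero]

/-- The derivative of order `a` in `x` and `b` in `y` (with `true` standing for one) at
`(x, y)`. -/
def nodal (a b : Bool) (x y : ℝ) (v : Poly2) : ℝ :=
  ev ((bif a then dX else id) ((bif b then dY else id) v)) x y

theorem nodal_sum_smul {ι : Type*} (s : Finset ι) (a b : Bool) (x y : ℝ) (c : ι → ℝ)
    (f : ι → Poly2) :
    nodal a b x y (∑ i ∈ s, c i • f i) = ∑ i ∈ s, c i * nodal a b x y (f i) := by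
  cases a <;> cases b <;> simp [nodal, ev, dX, dY, smul_eval]

theorem nodal_neg (a b : Bool) (x y : ℝ) (v : Poly2) :
    nodal a b x y (-v) = -nodal a b x y v := by
  cases a <;> cases b <;> simp [nodal, ev, dX, dY]

theorem nodal_injective {a b a' b' : Bool} {x y x' y' : ℝ}
    (h : nodal a b x y = nodal a' b' x' y') : a = a' ∧ b = b' ∧ x = x' ∧ y = y' := by
  have h1 := congrFun h 1
  have h2 := congrFun h (X 0)
  have h3 := congrFun h (X 1)
  have h4 := congrFun h (X 0 * X 1)
  have h5 := congrFun h (X 0 * X 0)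
  have h6 := congrFun h (X 1 * X 1)
  have h7 := congrFun h (X 0 * X 0 * X 1)
  have h8 := congrFun h (X 0 * X 1 * X 1)
  cases a <;> cases b <;> cases a' <;> cases b' <;>
    simp [nodal, ev, dX, dY, Derivation.leibniz, pderiv_X] at h1 h2 h3 h4 h5 h6 h7 h8 ⊢ <;>
    constructor <;> linarith

theorem finrank_restrictTotalDegree_fin_two (k : ℕ) :
    Module.finrank ℝ (restrictTotalDegree (Fin 2) ℝ k) = (k + 1) * (k + 2) / 2 := by
  classical
  have hset : {n : Fin 2 →₀ ℕ | (n.sum fun _ e => e) ≤ k}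
      = ((Finset.range (k + 1)).biUnion fun n => Finset.finsuppAntidiag Finset.univ n :
          Finset (Fin 2 →₀ ℕ)) := by
    ext n
    simp [Finsupp.sum_fintype]
  rw [restrictTotalDegree, Module.finrank_eq_nat_card_basis (basisRestrictSupport ℝ _), hset,
    Nat.card_coe_set_eq, Set.ncard_coe_finset, Finset.card_biUnion]
  · have : ∀ n : ℕ, (2 + n - 1).choose n = n + 1 := fun n => by
      rw [show 2 + n - 1 = n + 1 by omega, Nat.choose_succ_self_right]
    simp only [Finset.card_finsuppAntidiag_nat_eq_choose, Finset.card_univ, Fintype.card_fin, this]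
    have h := Finset.sum_range_id_mul_two (k + 2)
    rw [Finset.sum_range_succ'] at h
    simp at h
    rw [show (k + 1) * (k + 2) = (k + 2) * (k + 1) by ring, ← h]
    simp [Finset.sum_add_distrib]
  · intro i _ j _ hij
    rw [Function.onFun, Finset.disjoint_left]
    intro n hi hj
    rw [Finset.mem_finsuppAntidiag] at hi hj
    exact hij (hi.1.symm.trans hj.1)

instance finiteDimensional_restrictTotalDegree_fin_two (k : ℕ) :
    FiniteDimensional ℝ (restrictTotalDegree (Fin 2) ℝ k) :=
  Module.finite_of_finrank_pos (by
    rw [finrank_restrictTotalDegree_fin_two]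
    exact Nat.div_pos (by nlinarith) two_pos)

theorem eq_zero_of_bellDofs_eq_zero {k : ℕ} (hk : 4 ≤ k) {p : Poly2} (hdeg : p.totalDegree ≤ k)
    (h : ∀ a b x y, nodal a b x y ∈ BellDofs k → x = 0 ∨ y ≠ 0 → nodal a b x y p = 0) :
    p = 0 := by
  have hk2 : ((k - 2 : ℕ) : ℝ) = (k : ℝ) - 2 := by
    rw [Nat.cast_sub (by omega)]; norm_num
  have hk3 : ((k - 3 : ℕ) : ℝ) = (k : ℝ) - 3 := by
    rw [Nat.cast_sub (by omega)]; norm_num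
  have hk2pos : (0 : ℝ) < (k - 2 : ℕ) := Nat.cast_pos.2 (by omega)
  have hk3pos : (0 : ℝ) < (k - 3 : ℕ) := Nat.cast_pos.2 (by omega)
  have value : ∀ i j : ℕ, i ≤ k - 2 → j ≤ k - 2 → i = 0 ∨ j ≠ 0 →
      ev p ((i : ℝ) / (k - 2 : ℕ)) ((j : ℝ) / (k - 2 : ℕ)) = 0 := by
    intro i j hi hj hij
    refine h false false _ _ (Or.inl ⟨i, j, hi, hj, ?_⟩) ?_
    · rw [hk2]; rfl
    · simpa [hk2pos.ne'] using hij
  have derivX : ∀ i j : ℕ, i ≤ 1 → j ≤ k - 3 → i = 0 ∨ j ≠ 0 →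
      ev (dX p) i ((j : ℝ) / (k - 3 : ℕ)) = 0 := by
    intro i j hi hj hij
    refine h true false _ _ (Or.inr (Or.inl ⟨i, j, hi, hj, ?_⟩)) ?_
    · rw [hk3]; rfl
    · simpa [hk3pos.ne'] using hij
  have derivY : ∀ i j : ℕ, i ≤ k - 3 → j ≤ 1 → i = 0 ∨ j ≠ 0 →
      ev (dY p) ((i : ℝ) / (k - 3 : ℕ)) j = 0 := by
    intro i j hi hj hij
    refine h false true _ _ (Or.inr (Or.inr (Or.inl ⟨i, j, hi, hj, ?_⟩))) ?_
    · rw [hk3]; rfl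
    · simpa [hk3pos.ne'] using hij
  have derivXY : ∀ i j : ℕ, i ≤ 1 → j ≤ 1 → i = 0 ∨ j ≠ 0 → ev (dX (dY p)) i j = 0 := by
    intro i j hi hj hij
    refine h true true _ _ (Or.inr (Or.inr (Or.inr ⟨i, j, hi, hj, rfl⟩))) ?_
    simpa using hij
  have hdegX : (dX p).totalDegree ≤ k - 3 + 2 :=
    (totalDegree_pderiv_le_sub_one 0 p).trans (by omega)
  have hdegY : (dY p).totalDegree ≤ k - 3 + 2 :=
    (totalDegree_pderiv_le_sub_one 1 p).trans (by omega)
  have left : lineX 0 p = 0 := by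
    refine Polynomial.eq_zero_of_hermite_nodes (m := k - 2) (by omega)
      (natDegree_lineX_le _ (by omega)) (fun j hj => ?_) ?_ ?_
    · simpa [eval_lineX] using value 0 j (by omega) hj (by simp)
    · simpa [derivative_lineX, eval_lineX] using derivY 0 0 (by omega) (by omega) (by simp)
    · simpa [derivative_lineX, eval_lineX] using derivY 0 1 (by omega) (by omega) (by simp)
  have left' : lineX 0 (dX p) = 0 := by
    refine Polynomial.eq_zero_of_hermite_nodes (m := k - 3) (by omega)
      (natDegree_lineX_le _ hdegX) (fun j hj => ?_) ?_ ?_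
    · simpa [eval_lineX] using derivX 0 j (by omega) hj (by simp)
    · simpa [derivative_lineX, eval_lineX, dX_dY_comm] using
        derivXY 0 0 (by omega) (by omega) (by simp)
    · simpa [derivative_lineX, eval_lineX, dX_dY_comm] using
        derivXY 0 1 (by omega) (by omega) (by simp)
  have top : lineY 1 p = 0 := by
    refine Polynomial.eq_zero_of_hermite_nodes (m := k - 2) (by omega)
      (natDegree_lineY_le _ (by omega)) (fun j hj => ?_) ?_ ?_
    · simpa [eval_lineY, div_self hk2pos.ne'] using value j (k - 2) hj le_rfl (by omega)
    · simpa [derivative_lineY, eval_lineY, div_self hk3pos.ne'] using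
        derivX 0 (k - 3) (by omega) le_rfl (by omega)
    · simpa [derivative_lineY, eval_lineY, div_self hk3pos.ne'] using
        derivX 1 (k - 3) (by omega) le_rfl (by omega)
  have top' : lineY 1 (dY p) = 0 := by
    refine Polynomial.eq_zero_of_hermite_nodes (m := k - 3) (by omega)
      (natDegree_lineY_le _ hdegY) (fun j hj => ?_) ?_ ?_
    · simpa [eval_lineY] using derivY j 1 hj le_rfl (by simp)
    · simpa [derivative_lineY, eval_lineY] using
        derivXY 0 1 (by omega) (by omega) (by simp)
    · simpa [derivative_lineY, eval_lineY] using
        derivXY 1 1 (by omega) (by omega) (by simp)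
  have hX : (X 0 - C 0 : Poly2) ^ 2 ∣ p := by
    refine X_sub_C_sq_dvd 0 0 (fun v hv => ?_) (fun v hv => ?_)
    · rw [eval_eq_ev, hv, ← eval_lineX, left, Polynomial.eval_zero]
    · rw [eval_eq_ev, hv, ← eval_lineX, ← dX, left', Polynomial.eval_zero]
  have hY : (X 1 - C 1 : Poly2) ^ 2 ∣ p := by
    refine X_sub_C_sq_dvd 1 1 (fun v hv => ?_) (fun v hv => ?_)
    · rw [eval_eq_ev, hv, ← eval_lineY, top, Polynomial.eval_zero]
    · rw [eval_eq_ev, hv, ← eval_lineY, ← dY, top', Polynomial.eval_zero]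
  obtain ⟨r, rfl⟩ := hY
  have hprime : Prime (X 0 - C 0 : Poly2) := by simpa using X_prime (R := ℝ) (i := (0 : Fin 2))
  obtain ⟨q, rfl⟩ := hprime.pow_dvd_of_dvd_mul_left 2 (fun ⟨s, hs⟩ => by
    simpa using congrArg (eval fun _ => (0 : ℝ)) hs) hX
  suffices hq : q = 0 by simp [hq]
  by_contra hq
  have hqdeg : q.totalDegree + 4 ≤ k := by
    have hne : (X 0 - C 0 : Poly2) ^ 2 * q ≠ 0 := mul_ne_zero (pow_ne_zero 2 hprime.ne_zero) hq
    have h1 := totalDegree_X_sub_C_sq_mul 0 0 hq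
    have h2 := totalDegree_X_sub_C_sq_mul 1 1 hne
    omega
  refine hq (eq_zero_of_lineX_eq_zero (m := k - 2) (n := k - 2) (by omega) (by omega)
    fun i hi hi' => ?_)
  refine Polynomial.eq_zero_of_uniform_nodes (m := k - 2) (n := k - 3) (by omega)
    ((natDegree_lineX_le _ le_rfl).trans_lt (by omega)) fun j hj hj' => ?_
  rw [eval_lineX]
  have hval := value i j hi' (by omega) (by omega)
  have hi0 : (i : ℝ) / (k - 2 : ℕ) ≠ 0 :=
    div_ne_zero (Nat.cast_ne_zero.2 (by omega)) hk2pos.ne'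
  have hj1 : (j : ℝ) / (k - 2 : ℕ) - 1 ≠ 0 := by
    rw [sub_ne_zero, Ne, div_eq_one_iff_eq hk2pos.ne']
    exact fun hjk => by have := Nat.cast_injective hjk; omega
  generalize (i : ℝ) / (k - 2 : ℕ) = x at *
  generalize (j : ℝ) / (k - 2 : ℕ) = y at *
  simpa [ev, hi0, hj1] using hval

/-- The derivative orders and points of the eight functionals dual to the enrichment functions. -/
def enrichmentNode (k : ℕ) : Fin 8 → Bool × Bool × ℝ × ℝ :=
  ![(false, false, 1 / ((k : ℝ) - 2), 0), (false, false, 2 / ((k : ℝ) - 2), 0),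
    (false, true, 1 / ((k : ℝ) - 3), 0), (false, true, 2 / ((k : ℝ) - 3), 0),
    (false, false, 1, 0), (true, false, 1, 0), (false, true, 1, 0), (true, true, 1, 0)]

/-- The functional `nodal` with its parameters in a tuple. -/
def nodalAt (t : Bool × Bool × ℝ × ℝ) : Poly2 → ℝ := nodal t.1 t.2.1 t.2.2.1 t.2.2.2

theorem nodalAt_injective : Function.Injective nodalAt := by
  rintro ⟨a, b, x, y⟩ ⟨a', b', x', y'⟩ h
  obtain ⟨rfl, rfl, rfl, rfl⟩ := nodal_injective h
  rfl

theorem enrichmentNode_injective {k : ℕ} (hk : 6 ≤ k) :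
    Function.Injective (enrichmentNode k) := by
  have hk' : (6 : ℝ) ≤ k := by exact_mod_cast hk
  have h2 : (k : ℝ) - 2 ≠ 0 := by linarith
  have h3 : (k : ℝ) - 3 ≠ 0 := by linarith
  have e1 : (k : ℝ) - 2 ≠ 1 := by intro h; linarith
  have e2 : (k : ℝ) - 2 ≠ 2 := by intro h; linarith
  have e3 : (k : ℝ) - 3 ≠ 1 := by intro h; linarith
  have e4 : (k : ℝ) - 3 ≠ 2 := by intro h; linarith
  intro i j hij
  fin_cases i <;> fin_cases j <;>
    simp [enrichmentNode, div_eq_iff, eq_div_iff, h2, h3, e1, e2, e3, e4, e2.symm, e4.symm]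
      at hij ⊢

theorem enrichmentNode_coord {k : ℕ} (hk : 6 ≤ k) (i : Fin 8) :
    (enrichmentNode k i).2.2.1 ≠ 0 ∧ (enrichmentNode k i).2.2.2 = 0 := by
  have hk' : (6 : ℝ) ≤ k := by exact_mod_cast hk
  have h2 : (k : ℝ) - 2 ≠ 0 := by linarith
  have h3 : (k : ℝ) - 3 ≠ 0 := by linarith
  fin_cases i <;> simp [enrichmentNode, h2, h3]

theorem nodalAt_enrichmentNode_mem {k : ℕ} (hk : 6 ≤ k) (i : Fin 8) :
    nodalAt (enrichmentNode k i) ∈ BellDofs k := by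
  have hk' : (6 : ℝ) ≤ k := by exact_mod_cast hk
  have h2 : ((k - 2 : ℕ) : ℝ) / ((k : ℝ) - 2) = 1 := by
    rw [Nat.cast_sub (by omega), Nat.cast_ofNat, div_self (by linarith)]
  have h3 : ((k - 3 : ℕ) : ℝ) / ((k : ℝ) - 3) = 1 := by
    rw [Nat.cast_sub (by omega), Nat.cast_ofNat, div_self (by linarith)]
  fin_cases i
  · exact Or.inl ⟨1, 0, by omega, by omega, by simp only [Nat.cast_one, Nat.cast_zero, zero_div]; rfl⟩
  · exact Or.inl ⟨2, 0, by omega, by omega, by simp; rfl⟩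
  · exact Or.inr (Or.inr (Or.inl
      ⟨1, 0, by omega, by omega, by simp only [Nat.cast_one, Nat.cast_zero]; rfl⟩))
  · exact Or.inr (Or.inr (Or.inl ⟨2, 0, by omega, by omega, by simp; rfl⟩))
  · exact Or.inl ⟨k - 2, 0, by omega, by omega, by rw [h2]; simp; rfl⟩
  · exact Or.inr (Or.inl ⟨1, 0, by omega, by omega, by simp; rfl⟩)
  · exact Or.inr (Or.inr (Or.inl ⟨k - 3, 0, by omega, by omega, by rw [h3]; simp; rfl⟩))
  · exact Or.inr (Or.inr (Or.inr ⟨1, 0, by omega, by omega, by simp; rfl⟩))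

/-- for `k ≥ 6`, `P_k ∩ span{b₁,…,b₈} = {0}`, and the bubble-enriched space
`V_k(T) = P_k + span{b₁,…,b₈}` has dimension `(k+1)(k+2)/2 + 8`. -/
theorem stmt_15
    (k : ℕ) (hk : 6 ≤ k)
    (b : Fin 8 → Poly2)
    (hW : ∀ i, BellSpace k (b i))
    (hb1 : IsDualTo k (fun v => ev v (1 / ((k : ℝ) - 2)) 0) (b 0))
    (hb2 : IsDualTo k (fun v => ev v (2 / ((k : ℝ) - 2)) 0) (b 1))
    (hb3 : IsDualTo k (fun v => ev (dY v) (1 / ((k : ℝ) - 3)) 0) (b 2))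
    (hb4 : IsDualTo k (fun v => ev (dY v) (2 / ((k : ℝ) - 3)) 0) (b 3))
    (hb5 : IsDualTo k (fun v => ev v 1 0) (b 4))
    (hb6 : IsDualTo k (fun v => ev (dX v) 1 0) (b 5))
    (hb7 : IsDualTo k (fun v => ev (dY v) 1 0) (b 6))
    (hb8 : IsDualTo k (fun v => ev (dX (dY v)) 1 0) (b 7)) :
    (∀ (p : Poly2), p.totalDegree ≤ k → ∀ c : Fin 8 → ℝ,
      p + ∑ i, c i • b i = 0 → p = 0 ∧ ∀ i, c i = 0) ∧
    Module.finrank ℝ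
      ↥(MvPolynomial.restrictTotalDegree (Fin 2) ℝ k ⊔
          Submodule.span ℝ (Set.range b)) = (k + 1) * (k + 2) / 2 + 8 := by
  have hdual : ∀ i, IsDualTo k (nodalAt (enrichmentNode k i)) (b i) := by
    intro i
    fin_cases i
    exacts [hb1, hb2, hb3, hb4, hb5, hb6, hb7, hb8]
  have hindep : ∀ p : Poly2, p.totalDegree ≤ k → ∀ c : Fin 8 → ℝ,
      p + ∑ i, c i • b i = 0 → p = 0 ∧ ∀ i, c i = 0 := by
    intro p hp c hsum
    have hpc : p = -∑ i, c i • b i := eq_neg_of_add_eq_zero_left hsum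
    have hp0 : p = 0 := by
      refine eq_zero_of_bellDofs_eq_zero (by omega) hp fun a b' x y hmem hxy => ?_
      rw [hpc, nodal_neg, nodal_sum_smul, Finset.sum_eq_zero, neg_zero]
      intro i _
      rw [(hdual i).2 _ hmem, mul_zero]
      intro heq
      have hnode := nodalAt_injective (a₁ := (a, b', x, y)) heq
      have hcoord := enrichmentNode_coord hk i
      rw [← hnode] at hcoord
      exact hxy.elim hcoord.1 fun hy => hy hcoord.2
    refine ⟨hp0, fun i => ?_⟩
    have hF := congrArg (nodalAt (enrichmentNode k i)) (hp0.symm.trans hpc)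
    rw [nodalAt, nodal_neg, nodal_sum_smul, Finset.sum_eq_single i, ← nodalAt, (hdual i).1] at hF
    · have h0 : nodalAt (enrichmentNode k i) 0 = 0 := by
        simpa [nodalAt] using nodal_sum_smul (∅ : Finset (Fin 8)) (enrichmentNode k i).1
          (enrichmentNode k i).2.1 (enrichmentNode k i).2.2.1 (enrichmentNode k i).2.2.2 c b
      linarith
    · intro j _ hji
      rw [← nodalAt, (hdual j).2 _ (nodalAt_enrichmentNode_mem hk i), mul_zero]
      exact fun heq => hji (enrichmentNode_injective hk (nodalAt_injective heq)).symm
    · simp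
  refine ⟨hindep, ?_⟩
  have hli : LinearIndependent ℝ b :=
    Fintype.linearIndependent_iff.2 fun c hc => (hindep 0 (by simp) c (by simpa using hc)).2
  have hdisj : restrictTotalDegree (Fin 2) ℝ k ⊓ Submodule.span ℝ (Set.range b) = ⊥ := by
    rw [← disjoint_iff, Submodule.disjoint_def]
    intro p hp hpb
    obtain ⟨c, rfl⟩ := (Submodule.mem_span_range_iff_exists_fun ℝ).1 hpb
    exact (hindep _ ((mem_restrictTotalDegree _ _ _).1 hp) (-c) (by simp)).1
  have : FiniteDimensional ℝ (Submodule.span ℝ (Set.range b)) :=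
    FiniteDimensional.span_of_finite ℝ (Set.finite_range b)
  have hrank := Submodule.finrank_sup_add_finrank_inf_eq (restrictTotalDegree (Fin 2) ℝ k)
    (Submodule.span ℝ (Set.range b))
  rwa [hdisj, finrank_bot, add_zero, finrank_restrictTotalDegree_fin_two,
    finrank_span_eq_card hli, Fintype.card_fin] at hrank
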